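/- Let s ≥ 2, let n_1,…,n_s be positive integers with n_1 + ⋯ + n_s = K, and let M ⊂ (0,∞) be a set of r distinct positive real numbers with r ≥ s−1. Suppose a = (a_1,…,a_s) and a' = (a'_1,…,a'_s) satisfy a_1 > ⋯ > a_s > 0, a'_1 > ⋯ > a'_s > 0, ∑_{j=1}^s n_j a_j = 1, and ∑_{j=1}^s n_j a'_j = 1, and let p (resp. p') be the probability vector consisting of n_j copies of a_j (resp. a'_j). If H_m(p) = H_m(p') for every m ∈ M, then a = a'. That is, on the ordered stratum of distributions with known multiplicity structure (n_1,…,n_s), any s−1 distinct positive orders of GSE determine the distribution. -/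

import Mathlib

/-- GSE of order `m` of the probability vector consisting of `n j` copies of `a j`
(for `j = 1, …, s`): `H_m(p) = -∑ j, n j * (a j ^ m / S) * log (a j ^ m / S)` where
`S = ∑ j, n j * a j ^ m`. -/
noncomputable def GSEstratum (s : ℕ) (n : Fin s → ℕ) (m : ℝ) (a : Fin s → ℝ) : ℝ :=
  -∑ j, (n j : ℝ) * (a j ^ m / ∑ i, (n i : ℝ) * a i ^ m) *
      Real.log (a j ^ m / ∑ i, (n i : ℝ) * a i ^ m)

open Filter Topology

/-- The exponential sum `∑ j, c j * exp (m * x j)`. -/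
noncomputable def expSum {ι : Type*} [Fintype ι] (c x : ι → ℝ) (m : ℝ) : ℝ :=
  ∑ j, c j * Real.exp (m * x j)

theorem hasDerivAt_expSum {ι : Type*} [Fintype ι] (c x : ι → ℝ) (m : ℝ) :
    HasDerivAt (expSum c x) (expSum (c * x) x m) m := by
  unfold expSum
  refine HasDerivAt.fun_sum fun j _ => ?_
  have h := (((hasDerivAt_id m).mul_const (x j)).exp).const_mul (c j)
  refine h.congr_deriv ?_
  simp only [id, Pi.mul_apply]
  ring

theorem expSum_pos {ι : Type*} [Fintype ι] [Nonempty ι] {c : ι → ℝ} (hc : ∀ j, 0 < c j)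
    (x : ι → ℝ) (m : ℝ) : 0 < expSum c x m :=
  Finset.sum_pos (fun j _ => mul_pos (hc j) (Real.exp_pos _)) Finset.univ_nonempty

theorem expSum_sub_const {ι : Type*} [Fintype ι] (c x : ι → ℝ) (b m : ℝ) :
    expSum c (fun j => x j - b) m = Real.exp (-(m * b)) * expSum c x m := by
  unfold expSum
  rw [Finset.mul_sum]
  refine Finset.sum_congr rfl fun j _ => ?_
  rw [mul_sub, sub_eq_neg_add, Real.exp_add]
  ring

theorem tendsto_expSum_atBot {N : ℕ} (c : Fin (N + 1) → ℝ) {x : Fin (N + 1) → ℝ} (hx : StrictMono x)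
    (h0 : x 0 = 0) : Tendsto (expSum c x) atBot (𝓝 (c 0)) := by
  have h : Tendsto (fun m => ∑ j, c j * Real.exp (m * x j)) atBot
      (𝓝 (∑ j : Fin (N + 1), if j = 0 then c 0 else 0)) := by
    refine tendsto_finsetSum _ fun j _ => ?_
    by_cases hj : j = 0
    · subst hj; simp [h0]
    · have hxj : 0 < x j := h0 ▸ hx (Fin.pos_iff_ne_zero.2 hj)
      have := (Real.tendsto_exp_atBot.comp (tendsto_id.atBot_mul_const hxj)).const_mul (c j)
      simpa [hj] using this
  rw [Finset.sum_ite_eq' Finset.univ (0 : Fin (N + 1)) fun _ => c 0, if_pos (Finset.mem_univ _)] at h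
  exact h

/-- The Wronskian of the exponential sums with coefficients `c` and `c * v`. -/
noncomputable def expWronskian {ι : Type*} [Fintype ι] (c x v : ι → ℝ) (m : ℝ) : ℝ :=
  expSum c x m * expSum (c * v * x) x m - expSum (c * x) x m * expSum (c * v) x m

theorem expWronskian_sub_const {ι : Type*} [Fintype ι] (c x v : ι → ℝ) (b m : ℝ) :
    expWronskian c (fun j => x j - b) v m = Real.exp (-(m * b)) ^ 2 * expWronskian c x v m := by
  have h (c' : ι → ℝ) : expSum (c' * fun j => x j - b) x m =
      expSum (c' * x) x m - b * expSum c' x m := by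
    simp only [expSum, Finset.mul_sum, ← Finset.sum_sub_distrib, Pi.mul_apply]
    exact Finset.sum_congr rfl fun j _ => by ring
  simp only [expWronskian, expSum_sub_const, h]
  ring

theorem exists_deriv_nonneg_of_tendsto_atBot {f f' : ℝ → ℝ} (hf : ∀ m, HasDerivAt f (f' m) m)
    {l p : ℝ} (hl : Tendsto f atBot (𝓝 l)) (hp : l ≤ f p) : ∃ q < p, 0 ≤ f' q := by
  by_contra! h
  have hanti : StrictAntiOn f (Set.Iic p) := by
    refine strictAntiOn_of_deriv_neg (convex_Iic p)
      (fun m _ => (hf m).continuousAt.continuousWithinAt) fun m hm => ?_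
    rw [interior_Iic] at hm
    rw [(hf m).deriv]
    exact h m hm
  have h1 : f (p - 1) ≤ l := by
    refine ge_of_tendsto hl ?_
    filter_upwards [eventually_le_atBot (p - 1)] with m hm
    exact hanti.antitoneOn (Set.mem_Iic.2 (by linarith)) (Set.mem_Iic.2 (by linarith)) hm
  have h2 := hanti (Set.mem_Iic.2 (by linarith : p - 1 ≤ p)) (Set.mem_Iic.2 le_rfl) (by linarith)
  linarith

theorem exists_deriv_nonneg_of_le {f f' : ℝ → ℝ} (hf : ∀ m, HasDerivAt f (f' m) m)
    {p q : ℝ} (hpq : p < q) (h : f p ≤ f q) : ∃ t ∈ Set.Ioo p q, 0 ≤ f' t := by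
  obtain ⟨t, ht, he⟩ := exists_hasDerivAt_eq_slope f f' hpq
    (fun m _ => (hf m).continuousAt.continuousWithinAt) fun m _ => hf m
  exact ⟨t, ht, he ▸ div_nonneg (by linarith) (by linarith)⟩

theorem expWronskian_reduction {N : ℕ} {c x : Fin (N + 2) → ℝ} (hc : ∀ j, 0 < c j)
    (hx : StrictMono x) (h0 : x 0 = 0) (v : Fin (N + 2) → ℝ) :
    ∃ Θ : ℝ → ℝ, ∃ α β : ℝ → ℝ, (∀ m, 0 < α m) ∧ (∀ m, 0 < β m) ∧
      (∀ m, Θ m = α m * expWronskian c x v m) ∧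
      (∀ m, HasDerivAt Θ (β m * expWronskian (fun j : Fin (N + 1) => c j.succ * x j.succ)
        (fun j => x j.succ) (fun j => v j.succ) m) m) ∧
      Tendsto Θ atBot (𝓝 (c 0 * (v 1 - v 0))) := by
  have hxpos (j : Fin (N + 1)) : 0 < x j.succ := h0 ▸ hx j.succ_pos
  set c' : Fin (N + 1) → ℝ := fun j => c j.succ * x j.succ with hc'
  set x' : Fin (N + 1) → ℝ := fun j => x j.succ with hx'
  set v' : Fin (N + 1) → ℝ := fun j => v j.succ with hv'
  have hc'pos (j) : 0 < c' j := mul_pos (hc _) (hxpos j)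
  have hZ m := expSum_pos hc x m
  have hQ m := expSum_pos hc'pos x' m
  have hQe m : expSum (c * x) x m = expSum c' x' m := by
    simp [expSum, Fin.sum_univ_succ, h0, hc', hx']
  have hPe m : expSum (c * v * x) x m = expSum (c' * v') x' m := by
    simp only [expSum, Fin.sum_univ_succ (n := N + 1), h0, hc', hx', hv', Pi.mul_apply]
    simp only [mul_zero, zero_mul, zero_add]
    exact Finset.sum_congr rfl fun j _ => by ring
  refine ⟨fun m => expSum c x m * (expSum (c' * v') x' m / expSum c' x' m) - expSum (c * v) x m,
    fun m => 1 / expSum c' x' m, fun m => expSum c x m / expSum c' x' m ^ 2,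
    fun m => one_div_pos.2 (hQ m), fun m => div_pos (hZ m) (pow_pos (hQ m) 2), fun m => ?_,
    fun m => ?_, ?_⟩
  · have := (hQ m).ne'
    simp only [expWronskian, hQe, hPe]
    field_simp
  · have h := ((hasDerivAt_expSum c x m).mul ((hasDerivAt_expSum (c' * v') x' m).div
      (hasDerivAt_expSum c' x' m) (hQ m).ne')).sub (hasDerivAt_expSum (c * v) x m)
    refine h.congr_deriv ?_
    have := (hQ m).ne'
    simp only [expWronskian, hQe, hPe, Pi.div_apply]
    field_simp
    ring
  · have hx'' : StrictMono fun j => x' j - x' 0 := fun i j hij =>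
      sub_lt_sub_right (hx (Fin.succ_lt_succ_iff.2 hij)) _
    have hr : Tendsto (fun m => expSum (c' * v') x' m / expSum c' x' m) atBot (𝓝 (v 1)) := by
      have h := (tendsto_expSum_atBot (c' * v') hx'' (sub_self _)).div
        (tendsto_expSum_atBot c' hx'' (sub_self _)) (hc'pos 0).ne'
      have he : (c' * v') 0 / c' 0 = v 1 := by
        rw [Pi.mul_apply, mul_div_cancel_left₀ _ (hc'pos 0).ne']; rfl
      rw [he] at h
      refine h.congr fun m => ?_
      simp only [Pi.div_apply]
      rw [expSum_sub_const, expSum_sub_const, mul_div_mul_left _ _ (Real.exp_pos _).ne']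
    have h := ((tendsto_expSum_atBot c hx h0).mul hr).sub (tendsto_expSum_atBot (c * v) hx h0)
    simpa [mul_sub] using h

/-- Variation diminishing property of the Wronskian: weak sign alternations of the Wronskian
come from strict sign alternations of the increments of `v`, with the same orientation. -/
theorem exists_strictMono_of_expWronskian_alternating {N : ℕ} {c x : Fin (N + 1) → ℝ}
    (hc : ∀ j, 0 < c j) (hx : StrictMono x) {v : Fin (N + 1) → ℝ}
    (hv : ∃ k : Fin N, v k.succ - v k.castSucc ≠ 0) {r : ℕ} {p : Fin (r + 1) → ℝ}
    (hp : StrictMono p) (ε : ℝ) (hε : ε ≠ 0)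
    (h : ∀ i : Fin (r + 1), 0 ≤ ε * (-1) ^ (i : ℕ) * expWronskian c x v (p i)) :
    ∃ κ : Fin (r + 1) → Fin N, StrictMono κ ∧
      ∀ i : Fin (r + 1), 0 < ε * (-1) ^ (i : ℕ) * (v (κ i).succ - v (κ i).castSucc) := by
  induction N generalizing r ε with
  | zero => exact hv.elim fun k => k.elim0
  | succ N ih =>
    have hx' : StrictMono fun j => x j - x 0 := fun i j hij => sub_lt_sub_right (hx hij) _
    obtain ⟨Θ, α, β, hα, hβ, hΘ, hΘ', hlim⟩ :=
      expWronskian_reduction hc hx' (sub_self _) v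
    have hΘs (i : Fin (r + 1)) : 0 ≤ ε * (-1) ^ (i : ℕ) * Θ (p i) := by
      rw [hΘ, expWronskian_sub_const]
      have := mul_nonneg (mul_pos (hα (p i)) (pow_pos (Real.exp_pos (-(p i * x 0))) 2)).le (h i)
      linarith
    set x₁ : Fin (N + 1) → ℝ := fun j => x j.succ - x 0
    set c₁ : Fin (N + 1) → ℝ := fun j => c j.succ * (x j.succ - x 0)
    set v₁ : Fin (N + 1) → ℝ := fun j => v j.succ with hv₁
    have hx₁ : StrictMono x₁ := fun i j hij => hx' (Fin.succ_lt_succ_iff.2 hij)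
    have hc₁ (j) : 0 < c₁ j := mul_pos (hc _) (sub_pos.2 (hx j.succ_pos))
    have hgap (k : Fin N) : v₁ k.succ - v₁ k.castSucc = v k.succ.succ - v k.succ.castSucc := rfl
    have hderiv (s m : ℝ) : HasDerivAt (fun m => s * Θ m)
        (s * (β m * expWronskian c₁ x₁ v₁ m)) m := (hΘ' m).const_mul s
    have hsign {s m : ℝ} (hs : 0 ≤ s * (β m * expWronskian c₁ x₁ v₁ m)) :
        0 ≤ s * expWronskian c₁ x₁ v₁ m := by
      refine nonneg_of_mul_nonneg_right (a := β m) ?_ (hβ m)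
      linarith
    by_cases hv' : ∃ k : Fin N, v₁ k.succ - v₁ k.castSucc ≠ 0
    · have hq (i : Fin r) : ∃ t ∈ Set.Ioo (p i.castSucc) (p i.succ),
          0 ≤ ε * (-1) ^ ((i : ℕ) + 1) * expWronskian c₁ x₁ v₁ t := by
        obtain ⟨t, ht, hs⟩ := exists_deriv_nonneg_of_le (hderiv (ε * (-1) ^ ((i : ℕ) + 1)))
          (hp i.castSucc_lt_succ) (by
            have h1 := hΘs i.castSucc
            have h2 := hΘs i.succ
            simp only [Fin.val_castSucc, Fin.val_succ] at h1 h2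
            refine le_trans ?_ h2
            rw [pow_succ]
            linarith)
        exact ⟨t, ht, hsign hs⟩
      choose q hq hqs using hq
      have hqmono : StrictMono q := fun i j hij =>
        ((hq i).2.trans_le (hp.monotone (Fin.succ_le_castSucc_iff.2 hij))).trans (hq j).1
      rcases lt_or_ge 0 (ε * (v 1 - v 0)) with h0 | h0
      · cases r with
        | zero =>
          refine ⟨fun _ => 0, fun i j hij => absurd hij (by omega), fun i => ?_⟩
          have hi : (i : ℕ) = 0 := by omega
          simpa [hi] using h0
        | succ r =>
          obtain ⟨κ, hκ, hκs⟩ := ih hc₁ hx₁ hv' hqmono (-ε) (neg_ne_zero.2 hε) fun i => by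
            have := hqs i
            rw [pow_succ] at this
            linarith
          refine ⟨Fin.cons 0 fun i => (κ i).succ, ?_, ?_⟩
          · exact Fin.strictMono_cons.2
              ⟨fun i => (κ i).succ_pos, fun i j hij => Fin.succ_lt_succ_iff.2 (hκ hij)⟩
          · intro i
            refine Fin.cases ?_ (fun i => ?_) i
            · simpa using h0
            · have := hκs i
              rw [hgap] at this
              simp only [Fin.cons_succ, Fin.val_succ, pow_succ]
              linarith
      · obtain ⟨t, ht, hs⟩ := exists_deriv_nonneg_of_tendsto_atBot (hderiv ε)
          (hlim.const_mul ε) (p := p 0) (by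
            have h1 := hΘs 0
            simp only [Fin.val_zero, pow_zero, mul_one] at h1
            have h2 := mul_nonneg (hc 0).le (neg_nonneg.2 h0)
            linarith)
        obtain ⟨κ, hκ, hκs⟩ := ih hc₁ hx₁ hv' (r := r) (p := Fin.cons t q) (Fin.strictMono_cons.2
            ⟨fun i => ht.trans_le ((hp.monotone (Fin.zero_le _)).trans (hq i).1.le), hqmono⟩) ε hε
          fun i => by
            refine Fin.cases ?_ (fun i => ?_) i
            · simpa using hsign hs
            · simpa using hqs i
        exact ⟨fun i => (κ i).succ, fun i j hij => Fin.succ_lt_succ_iff.2 (hκ hij), hκs⟩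
    · push Not at hv'
      have hconst (j) : v₁ j = v₁ 0 := by
        induction j using Fin.induction with
        | zero => rfl
        | succ k hk => rw [← hk, ← sub_eq_zero, hv' k]
      have hW m : expWronskian c₁ x₁ v₁ m = 0 := by
        have hv₁c : v₁ = fun _ => v₁ 0 := funext hconst
        have h1 (d : Fin (N + 1) → ℝ) : expSum (d * v₁) x₁ m = v₁ 0 * expSum d x₁ m := by
          rw [expSum, expSum, Finset.mul_sum]
          exact Finset.sum_congr rfl fun j _ => by rw [Pi.mul_apply, hconst j]; ring
        rw [expWronskian, mul_right_comm c₁, h1, h1]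
        ring
      have hΘc (m) : Θ m = c 0 * (v 1 - v 0) := by
        have hd (m) : HasDerivAt Θ 0 m := by simpa [hW] using hΘ' m
        have := is_const_of_deriv_eq_zero (fun m => (hd m).differentiableAt) fun m => (hd m).deriv
        refine tendsto_nhds_unique (tendsto_const_nhds.congr fun t => this m t) hlim
      have h0 : v 1 - v 0 ≠ 0 := by
        obtain ⟨k, hk⟩ := hv
        revert hk
        refine Fin.cases id (fun k hk => (hk (hv' k)).elim) k
      have hpos : 0 < ε * (v 1 - v 0) := by
        refine lt_of_le_of_ne ?_ (mul_ne_zero hε h0).symm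
        have h1 := hΘs 0
        rw [hΘc] at h1
        simp only [Fin.val_zero, pow_zero, mul_one] at h1
        refine nonneg_of_mul_nonneg_right (a := c 0) ?_ (hc 0)
        linarith
      cases r with
      | zero =>
        refine ⟨fun _ => 0, fun i j hij => absurd hij (by omega), fun i => ?_⟩
        have hi : (i : ℕ) = 0 := by omega
        simpa [hi] using hpos
      | succ r =>
        have h1 := hΘs 1
        rw [hΘc] at h1
        simp only [Fin.val_one, pow_one] at h1
        have := mul_pos (hc 0) hpos
        linarith

/-- The sequence `u` has `r` strict sign alternations. -/
def HasAlternations {N : ℕ} (u : Fin N → ℝ) (r : ℕ) : Prop :=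
  ∃ ε : ℝ, ε ≠ 0 ∧ ∃ κ : Fin (r + 1) → Fin N, StrictMono κ ∧
    ∀ i : Fin (r + 1), 0 < ε * (-1) ^ (i : ℕ) * u (κ i)

theorem HasAlternations.cons {N : ℕ} {u : Fin N → ℝ} {r : ℕ} {ε : ℝ} (hε : ε ≠ 0)
    {κ : Fin (r + 1) → Fin N} (hκ : StrictMono κ)
    (h : ∀ i : Fin (r + 1), 0 < ε * (-1) ^ (i : ℕ) * u (κ i)) {k : Fin N} (hk : k < κ 0)
    (hu : 0 < -ε * u k) : HasAlternations u (r + 1) := by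
  refine ⟨-ε, neg_ne_zero.2 hε, Fin.cons k κ, Fin.strictMono_cons.2
    ⟨fun j => hk.trans_le (hκ.monotone (Fin.zero_le _)), hκ⟩, fun i => ?_⟩
  refine Fin.cases (by simpa using hu) (fun i => ?_) i
  have := h i
  simp only [Fin.cons_succ, Fin.val_succ, pow_succ]
  linarith

theorem exists_maximal_alternations {N : ℕ} {u : Fin N → ℝ} {k : Fin N} (hk : u k ≠ 0) :
    ∃ r, HasAlternations u r ∧ ¬ HasAlternations u (r + 1) := by
  by_contra! h
  have hall (r : ℕ) : HasAlternations u r := by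
    induction r with
    | zero =>
      refine ⟨u k, hk, fun _ => k, fun i j hij => absurd hij (by omega), fun i => ?_⟩
      have hi : (i : ℕ) = 0 := by omega
      simpa [hi] using hk
    | succ r ih => exact h r ih
  obtain ⟨_, _, κ, hκ, _⟩ := hall N
  have := Fintype.card_le_of_injective κ hκ.injective
  simp at this

/-- The Wronskian sampled at increasing points reverses the sign of no sequence of increments. -/
theorem eq_zero_of_expWronskian_sign_reversal {N : ℕ} {c x : Fin (N + 1) → ℝ}
    (hc : ∀ j, 0 < c j) (hx : StrictMono x) {v : Fin (N + 1) → ℝ} {p : Fin N → ℝ}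
    (hp : StrictMono p)
    (h : ∀ k : Fin N, (v k.succ - v k.castSucc) * expWronskian c x v (p k) ≤ 0) (k : Fin N) :
    v k.succ - v k.castSucc = 0 := by
  by_contra hk
  obtain ⟨r, ⟨ε, hε, κ, hκ, hs⟩, hr⟩ :=
    exists_maximal_alternations (u := fun k : Fin N => v k.succ - v k.castSucc) hk
  obtain ⟨κ', hκ', hs'⟩ := exists_strictMono_of_expWronskian_alternating hc hx ⟨k, hk⟩
    (hp.comp hκ) (-ε) (neg_ne_zero.2 hε) fun i => by
      have h1 := hs i
      have h2 := h (κ i)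
      by_contra! h3
      have h4 : 0 < ε * (-1) ^ (i : ℕ) * expWronskian c x v (p (κ i)) := by
        simp only [Function.comp] at h3
        linarith
      have h5 := mul_pos h1 h4
      have h6 : 0 ≤ (ε * (-1) ^ (i : ℕ)) ^ 2 := sq_nonneg _
      nlinarith
  have h0 := hs 0
  have h0' := hs' 0
  simp only [Fin.val_zero, pow_zero, mul_one] at h0 h0'
  rcases lt_trichotomy (κ 0) (κ' 0) with hlt | heq | hlt
  · exact hr (HasAlternations.cons (neg_ne_zero.2 hε) hκ' hs' hlt (by simpa using h0))
  · rw [heq] at h0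
    linarith
  · exact hr (HasAlternations.cons hε hκ hs hlt h0')

/-- A linear endomorphism of `ι → ℝ` reverses the sign of no nonzero vector. For the map of a matrix
this says that all principal minors are positive. -/
def NoSignReversal {ι : Type*} (L : (ι → ℝ) → (ι → ℝ)) : Prop :=
  ∀ u : ι → ℝ, (∀ i, u i * L u i ≤ 0) → u = 0

theorem NoSignReversal.transpose {ι : Type*} [Fintype ι] {A : Matrix ι ι ℝ}
    (hA : NoSignReversal A.mulVec) : NoSignReversal A.transpose.mulVec := by
  classical
  intro x hx
  by_contra hx0
  let s : ι → ℝ := fun i => if x i = 0 then 0 else 1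
  let d : ι → ℝ := fun i => if x i = 0 then 1 else -(A.transpose.mulVec x i) / x i
  have hd (i) : 0 ≤ d i := by
    simp only [d]
    split_ifs with h
    · exact zero_le_one
    · rw [show -(A.transpose.mulVec x i) / x i = -(x i * A.transpose.mulVec x i) / x i ^ 2 by
        field_simp]
      exact div_nonneg (neg_nonneg.2 (hx i)) (sq_nonneg _)
  have h1 : ∃ y, y ≠ 0 ∧
      (Matrix.diagonal s * A.transpose + Matrix.diagonal d).mulVec y = 0 := by
    refine ⟨x, hx0, funext fun i => ?_⟩
    rw [Matrix.add_mulVec, ← Matrix.mulVec_mulVec, Pi.add_apply, Matrix.mulVec_diagonal,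
      Matrix.mulVec_diagonal]
    by_cases h : x i = 0
    · simp [s, d, h]
    · simp only [s, d, h, if_false, Pi.zero_apply]
      field_simp
      ring
  rw [Matrix.exists_mulVec_eq_zero_iff, ← Matrix.det_transpose,
    ← Matrix.exists_mulVec_eq_zero_iff] at h1
  obtain ⟨y, hy0, hy⟩ := h1
  have hy' (i) : A.mulVec (s * y) i + d i * y i = 0 := by
    have := congrFun hy i
    rw [Matrix.transpose_add, Matrix.transpose_mul, Matrix.diagonal_transpose,
      Matrix.diagonal_transpose, Matrix.transpose_transpose, Matrix.add_mulVec,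
      ← Matrix.mulVec_mulVec, Pi.add_apply, Matrix.mulVec_diagonal] at this
    rwa [show (Matrix.diagonal s).mulVec y = s * y from
      funext fun j => Matrix.mulVec_diagonal _ _ _] at this
  have hz : s * y = 0 := hA _ fun i => by
    have hs : 0 ≤ s i := by simp only [s]; split_ifs <;> norm_num
    rw [show A.mulVec (s * y) i = -(d i * y i) by linarith [hy' i], Pi.mul_apply]
    nlinarith [mul_nonneg (mul_nonneg hs (hd i)) (sq_nonneg (y i))]
  refine hy0 (funext fun i => ?_)
  by_cases h : x i = 0
  · have := hy' i
    rw [hz, Matrix.mulVec_zero] at this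
    simpa [d, h] using this
  · simpa [s, h] using congrFun hz i

theorem NoSignReversal.exists_pos {ι : Type*} [Fintype ι] {A : Matrix ι ι ℝ}
    (hA : NoSignReversal A.mulVec) : ∃ u : ι → ℝ, (∀ i, 0 < u i) ∧ ∀ i, 0 < A.mulVec u i := by
  classical
  by_contra! hcon
  let P : Set (ι → ℝ) := {w | ∀ i, 0 < w i}
  have hPconv : Convex ℝ P := by
    have : P = Set.univ.pi fun _ => Set.Ioi 0 := by ext; simp [P]
    rw [this]
    exact convex_pi fun _ _ => convex_Ioi 0
  have hPopen : IsOpen P := by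
    have : P = Set.univ.pi fun _ => Set.Ioi 0 := by ext; simp [P]
    rw [this]
    exact isOpen_set_pi Set.finite_univ fun _ _ => isOpen_Ioi
  obtain ⟨f, c, hf, hfA⟩ := geometric_hahn_banach_open hPconv hPopen
    (hPconv.linear_image A.mulVecLin) (by
      rw [Set.disjoint_left]
      rintro _ hw ⟨u, hu, rfl⟩
      obtain ⟨i, hi⟩ := hcon u hu
      exact absurd (hw i) (not_lt.2 hi))
  have hmem {w : ι → ℝ} (hw : 0 ≤ w) {t : ℝ} (ht : 0 < t) : t • w + 1 ∈ P := fun i => by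
    have := mul_nonneg ht.le (hw i)
    simp only [Pi.add_apply, Pi.smul_apply, smul_eq_mul, Pi.one_apply]
    linarith
  have hneg {α β : ℝ} (h : ∀ t > 0, t * α + β ≤ c) : α ≤ 0 := by
    by_contra! hα
    have := h ((|c - β| + 1) / α) (by positivity)
    rw [div_mul_cancel₀ _ hα.ne'] at this
    linarith [le_abs_self (c - β)]
  have hf0 {w : ι → ℝ} (hw : 0 ≤ w) : f w ≤ 0 := hneg fun t ht => by
    simpa using (hf _ (hmem hw ht)).le
  have hfA0 {w : ι → ℝ} (hw : 0 ≤ w) : 0 ≤ f (A.mulVec w) := by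
    by_contra! hlt
    have h (t : ℝ) (ht : 0 < t) := hfA _ (Set.mem_image_of_mem _ (hmem hw ht))
    simp only [map_add, map_smul, Matrix.mulVecLin_apply, smul_eq_mul] at h
    have := h ((|f (A.mulVec 1) - c| + 1) / -f (A.mulVec w))
      (div_pos (by positivity) (by linarith))
    rw [div_neg, neg_mul, div_mul_cancel₀ _ hlt.ne] at this
    linarith [le_abs_self (f (A.mulVec 1) - c)]
  let y : ι → ℝ := fun i => -f (Pi.single i 1)
  have hfy (w : ι → ℝ) : f w = -∑ i, w i * y i := by
    conv_lhs => rw [pi_eq_sum_univ' w]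
    simp [y, Pi.single]
  have hsingle (i : ι) : (0 : ι → ℝ) ≤ Pi.single i 1 := Pi.single_nonneg.2 zero_le_one
  have hy0 : y = 0 := hA.transpose y fun i => by
    refine mul_nonpos_of_nonneg_of_nonpos (neg_nonneg.2 (hf0 (hsingle i))) ?_
    have := hfA0 (hsingle i)
    rw [hfy, Matrix.mulVec_single_one] at this
    simp only [Matrix.mulVec, dotProduct, Matrix.transpose_apply]
    simpa using this
  have hf1 : f 1 < c := hf 1 fun i => by simp
  have hfA1 := hfA _ (Set.mem_image_of_mem A.mulVecLin (show (1 : ι → ℝ) ∈ P from fun i => by simp))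
  rw [hfy, hy0] at hf1 hfA1
  simp only [Pi.zero_apply, mul_zero, Finset.sum_const_zero, neg_zero] at hf1 hfA1
  linarith

theorem NoSignReversal.exists_pos_on {ι : Type*} [Fintype ι] {A : Matrix ι ι ℝ}
    (hA : NoSignReversal A.mulVec) (S : Set ι) : ∃ u : ι → ℝ, (∀ i ∈ S, 0 < u i) ∧
      (∀ i ∉ S, u i = 0) ∧ ∀ i ∈ S, 0 < A.mulVec u i := by
  classical
  let C : Matrix ι ι ℝ := Matrix.of fun i j =>
    if i ∈ S then (if j ∈ S then A i j else 0) else if i = j then 1 else 0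
  have hCS (v : ι → ℝ) {i : ι} (hi : i ∈ S) : C.mulVec v i = A.mulVec (S.indicator v) i := by
    simp only [Matrix.mulVec, dotProduct, C, Matrix.of_apply, hi, if_true]
    refine Finset.sum_congr rfl fun j _ => ?_
    by_cases hj : j ∈ S <;> simp [hj]
  have hC : NoSignReversal C.mulVec := fun v hv => by
    have h0 (i) (hi : i ∉ S) : v i = 0 := by
      have h := hv i
      simp only [Matrix.mulVec, dotProduct, C, Matrix.of_apply, hi, if_false, ite_mul, one_mul,
        zero_mul, Finset.sum_ite_eq, Finset.mem_univ, if_true] at h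
      exact mul_self_eq_zero.1 (le_antisymm h (mul_self_nonneg _))
    have hind : S.indicator v = v := Set.indicator_eq_self.2 fun i hi => by
      by_contra h
      exact hi (h0 i h)
    refine hA v fun i => ?_
    by_cases hi : i ∈ S
    · have := hv i
      rwa [hCS v hi, hind] at this
    · rw [h0 i hi, zero_mul]
  obtain ⟨u, hu, hCu⟩ := hC.exists_pos
  exact ⟨S.indicator u, fun i hi => by simpa [hi] using hu i, fun i hi => by simp [hi],
    fun i hi => hCS u hi ▸ hCu i⟩

theorem NoSignReversal.eventually_ne {ι : Type*} [Fintype ι] {F : (ι → ℝ) → (ι → ℝ)}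
    {L : (ι → ℝ) →L[ℝ] (ι → ℝ)} {a : ι → ℝ} (hL : NoSignReversal L) (hF : HasFDerivAt F L a) :
    ∀ᶠ z in 𝓝 a, (∀ i, (z i - a i) * (F z i - F a i) ≤ 0) → z = a := by
  let q : (ι → ℝ) → ℝ := fun w => ∑ i, max (w i * L w i) 0
  have hq : Continuous q := by fun_prop
  obtain ⟨l, hl, hlq⟩ := (isCompact_sphere (0 : ι → ℝ) 1).exists_forall_le' hq.continuousOn
    (a := 0) (fun w hw => by
      refine lt_of_le_of_ne (Finset.sum_nonneg fun i _ => le_max_right _ _) fun h => ?_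
      rw [eq_comm, Finset.sum_eq_zero_iff_of_nonneg fun i _ => le_max_right _ _] at h
      have := hL w fun i => (le_max_left _ _).trans (h i (Finset.mem_univ i)).le
      simp [this] at hw)
  have hqd (d : ι → ℝ) : l * ‖d‖ ^ 2 ≤ q d := by
    by_cases hd : d = 0
    · simp [hd, q]
    have hn := norm_pos_iff.2 hd
    have h := hlq (‖d‖⁻¹ • d) (by simp [norm_smul, hn.ne'])
    have he : q (‖d‖⁻¹ • d) = (‖d‖⁻¹) ^ 2 * q d := by
      simp only [q, Finset.mul_sum, map_smul, Pi.smul_apply, smul_eq_mul]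
      refine Finset.sum_congr rfl fun i _ => ?_
      rw [mul_max_of_nonneg _ _ (sq_nonneg _), mul_zero]
      ring_nf
    rw [he] at h
    calc l * ‖d‖ ^ 2 ≤ (‖d‖⁻¹) ^ 2 * q d * ‖d‖ ^ 2 := by gcongr
      _ = q d := by field_simp
  set n : ℝ := (Fintype.card ι : ℝ)
  have hn1 : 0 < n + 1 := by positivity
  have hη : 0 < l / (n + 1) := div_pos hl hn1
  filter_upwards [hF.isLittleO.bound hη] with z hz h
  by_contra hne
  have hn : 0 < ‖z - a‖ := norm_pos_iff.2 (sub_ne_zero.2 hne)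
  have hterm (i) : max ((z - a) i * L (z - a) i) 0 ≤ l / (n + 1) * ‖z - a‖ ^ 2 := by
    refine max_le ?_ (by positivity)
    have h1 := (norm_le_pi_norm (F z - F a - L (z - a)) i).trans hz
    have h2 := norm_le_pi_norm (z - a) i
    have h3 := h i
    have h4 := mul_le_mul h2 h1 (norm_nonneg _) (norm_nonneg _)
    rw [← norm_mul, Real.norm_eq_abs] at h4
    have h5 := neg_abs_le ((z - a) i * (F z - F a - L (z - a)) i)
    simp only [Pi.sub_apply] at h4 h5 h3 ⊢
    nlinarith
  have hsum : q (z - a) ≤ n * (l / (n + 1) * ‖z - a‖ ^ 2) := by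
    refine (Finset.sum_le_sum fun i _ => hterm i).trans_eq ?_
    simp [n]
  have h1 := hqd (z - a)
  have h2 : n * (l / (n + 1) * ‖z - a‖ ^ 2) = l * ‖z - a‖ ^ 2 - l / (n + 1) * ‖z - a‖ ^ 2 := by
    have := hn1.ne'
    field_simp
    ring
  have : 0 < l / (n + 1) * ‖z - a‖ ^ 2 := by positivity
  linarith

theorem eventually_lt_of_hasFDerivAt {ι : Type*} [Fintype ι] {F : (ι → ℝ) → (ι → ℝ)}
    {L : (ι → ℝ) →L[ℝ] (ι → ℝ)} {z u : ι → ℝ} (hF : HasFDerivAt F L z) {i : ι} (hi : 0 < L u i) :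
    ∀ᶠ t in 𝓝[>] (0 : ℝ), F (z - t • u) i < F z i := by
  have hline : HasDerivAt (fun t : ℝ => z - t • u) (-u) 0 := by
    simpa using ((hasDerivAt_id (0 : ℝ)).smul_const u).const_sub z
  have hF0 : HasFDerivAt F L ((fun t : ℝ => z - t • u) 0) := by simpa using hF
  have hd := hasDerivAt_pi.1 (hF0.comp_hasDerivAt 0 hline) i
  have hlt : L (-u) i < 0 := by simpa using hi
  filter_upwards [hd.tendsto_slope_zero_right.eventually_lt_const hlt, self_mem_nhdsWithin]
    with t ht ht0
  have := neg_of_smul_neg_left ht (inv_nonneg.2 (le_of_lt ht0))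
  simpa using this

/-- A map whose derivatives reverse the sign of no vector is a P-function along ordered pairs. -/
theorem eq_of_le_of_noSignReversal {ι : Type*} [Fintype ι] {F : (ι → ℝ) → (ι → ℝ)}
    {F' : (ι → ℝ) → (ι → ℝ) →L[ℝ] (ι → ℝ)} {a b : ι → ℝ}
    (hF : ∀ z ∈ Set.Icc a b, HasFDerivAt F (F' z) z)
    (hN : ∀ z ∈ Set.Icc a b, NoSignReversal (F' z)) {x : ι → ℝ} (hx : x ∈ Set.Icc a b)
    (hle : ∀ i, x i ≠ a i → F x i ≤ F a i) : x = a := by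
  classical
  induction hn : (Finset.univ.filter fun i => x i ≠ a i).card using Nat.strong_induction_on
    generalizing x with
  | _ n ih =>
  by_contra hxa
  have hab : Set.Icc a x ⊆ Set.Icc a b := Set.Icc_subset_Icc_right hx.2
  have haI : a ∈ Set.Icc a x := ⟨le_rfl, hx.1⟩
  obtain ⟨δ, hδ, hiso⟩ := Metric.eventually_nhds_iff.1
    ((hN a (hab haI)).eventually_ne (hF a (hab haI)))
  have hFc : ContinuousOn F (Set.Icc a x) := fun z hz =>
    (hF z (hab hz)).continuousAt.continuousWithinAt
  let G : (ι → ℝ) → (ι → ℝ) := fun z i => if x i ≠ a i then F z i else 0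
  have hG : ContinuousOn G (Set.Icc a x) := continuousOn_pi.2 fun i => by
    by_cases hi : x i ≠ a i
    · simpa only [G, if_pos hi] using continuousOn_pi.1 hFc i
    · simpa only [G, if_neg hi] using continuousOn_const
  let X : Set (ι → ℝ) := {z ∈ Set.Icc a x ∩ {z | δ ≤ dist z a} | G z ≤ G a}
  have hclosed : IsClosed (Set.Icc a x ∩ {z | δ ≤ dist z a}) :=
    isClosed_Icc.inter (isClosed_le continuous_const (by fun_prop))
  have hXc : IsCompact X := isCompact_Icc.of_isClosed_subset
    (hclosed.isClosed_le (hG.mono Set.inter_subset_left) continuousOn_const)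
    fun z hz => hz.1.1
  have hGle {z : ι → ℝ} : G z ≤ G a ↔ ∀ i, x i ≠ a i → F z i ≤ F a i := by
    refine forall_congr' fun i => ?_
    by_cases hi : x i = a i <;> simp [G, hi]
  have hXmem {z : ι → ℝ} (hz : z ∈ Set.Icc a x) (hza : z ≠ a)
      (h : ∀ i, x i ≠ a i → F z i ≤ F a i) : z ∈ X := by
    refine ⟨⟨hz, ?_⟩, hGle.2 h⟩
    by_contra hlt
    refine hza (hiso (not_le.1 hlt) fun i => ?_)
    by_cases hi : x i = a i
    · have : z i = a i := le_antisymm (hi ▸ hz.2 i) (hz.1 i)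
      simp [this]
    · exact mul_nonpos_of_nonneg_of_nonpos (sub_nonneg.2 (hz.1 i)) (sub_nonpos.2 (h i hi))
  obtain ⟨z, hzX, hmin⟩ := hXc.exists_isMinOn ⟨x, hXmem ⟨hx.1, le_rfl⟩ hxa hle⟩
    (f := fun z => ∑ i, z i) (by fun_prop)
  have hzI : z ∈ Set.Icc a x := hzX.1.1
  have hzle := hGle.1 hzX.2
  have hza : z ≠ a := by
    rintro rfl
    have : δ ≤ dist z z := hzX.1.2
    rw [dist_self] at this
    linarith
  have hsub (i) (hi : z i ≠ a i) : x i ≠ a i := fun h =>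
    hi (le_antisymm (h ▸ hzI.2 i) (hzI.1 i))
  have hpos (i) (hi : x i ≠ a i) : a i < z i := by
    refine lt_of_le_of_ne (hzI.1 i) fun h => ?_
    refine hza (ih _ ?_ (hab hzI) (fun i hi => hzle i (hsub i hi)) rfl)
    rw [← hn]
    refine Finset.card_lt_card ⟨fun j hj => ?_, fun hss => ?_⟩
    · simp only [Finset.mem_filter, Finset.mem_univ, true_and] at hj ⊢
      exact hsub j hj
    · have := hss (Finset.mem_filter.2 ⟨Finset.mem_univ i, hi⟩)
      exact (Finset.mem_filter.1 this).2 h.symm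
  have hA : NoSignReversal (LinearMap.toMatrix' (F' z : (ι → ℝ) →ₗ[ℝ] (ι → ℝ))).mulVec := by
    have := hN z (hab hzI)
    intro u hu
    refine this u fun i => ?_
    simpa [LinearMap.toMatrix'_mulVec] using hu i
  obtain ⟨u, hu, hu0, hAu⟩ := hA.exists_pos_on {i | x i ≠ a i}
  obtain ⟨k, hk⟩ := Function.ne_iff.1 hxa
  have hu_nonneg (i) : 0 ≤ u i := by
    by_cases hi : x i ≠ a i
    · exact (hu i hi).le
    · exact (hu0 i hi).ge
  have hdec : ∀ᶠ t in 𝓝[>] (0 : ℝ), ∀ i, x i ≠ a i → F (z - t • u) i < F z i := by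
    refine eventually_all.2 fun i => ?_
    by_cases hi : x i ≠ a i
    · filter_upwards [eventually_lt_of_hasFDerivAt (hF z (hab hzI)) (u := u) (i := i)
        (by simpa [LinearMap.toMatrix'_mulVec] using hAu i hi)] with t ht _ using ht
    · exact Eventually.of_forall fun t h => absurd h hi
  have hge : ∀ᶠ t in 𝓝[>] (0 : ℝ), ∀ i, x i ≠ a i → a i < (z - t • u) i := by
    refine eventually_all.2 fun i => ?_
    by_cases hi : x i ≠ a i
    · have hc : Continuous fun t : ℝ => (z - t • u) i := by
        simp only [Pi.sub_apply, Pi.smul_apply, smul_eq_mul]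
        fun_prop
      have := (hc.tendsto 0).eventually_const_lt (u := a i) (by simpa using hpos i hi)
      filter_upwards [nhdsWithin_le_nhds this] with t ht _ using ht
    · exact Eventually.of_forall fun t h => absurd h hi
  obtain ⟨t, hdec, hge, ht⟩ := (hdec.and (hge.and self_mem_nhdsWithin)).exists
  have ht : 0 < t := ht
  have hle_z (i) : (z - t • u) i ≤ z i := by
    have := mul_nonneg ht.le (hu_nonneg i)
    simpa using this
  have hmem : z - t • u ∈ X := by
    refine hXmem ⟨fun i => ?_, fun i => (hle_z i).trans (hzI.2 i)⟩ (fun h => ?_)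
      fun i hi => (hdec i hi).le.trans (hzle i hi)
    · by_cases hi : x i ≠ a i
      · exact (hge i hi).le
      · simpa [hu0 i hi] using hzI.1 i
    · exact (hge k hk).ne (congrFun h k).symm
  have hlt : ∑ i, (z - t • u) i < ∑ i, z i := by
    refine Finset.sum_lt_sum (fun i _ => hle_z i) ⟨k, Finset.mem_univ k, ?_⟩
    simpa using mul_pos ht (hu k hk)
  exact absurd (hmin hmem) (not_le.2 hlt)

/-- Gale–Nikaido univalence on the positive orthant. -/
theorem injOn_of_noSignReversal {ι : Type*} [Fintype ι] {F : (ι → ℝ) → (ι → ℝ)}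
    {F' : (ι → ℝ) → (ι → ℝ) →L[ℝ] (ι → ℝ)}
    (hF : ∀ z : ι → ℝ, (∀ i, 0 < z i) → HasFDerivAt F (F' z) z)
    (hN : ∀ z : ι → ℝ, (∀ i, 0 < z i) → NoSignReversal (F' z)) :
    Set.InjOn F {z | ∀ i, 0 < z i} := by
  intro x hx y hy hxy
  let σ : ι → ℝ := fun i => if x i ≤ y i then 1 else -1
  have hσ : σ * σ = 1 := funext fun i => by
    simp only [σ, Pi.mul_apply]
    split_ifs <;> simp
  have hσσ (z : ι → ℝ) : σ * (σ * z) = z := by rw [← mul_assoc, hσ, one_mul]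
  have hle : σ * x ≤ σ * y := fun i => by
    simp only [σ, Pi.mul_apply]
    split_ifs with h
    · simpa using h
    · simpa using (not_le.1 h).le
  have hpos (z : ι → ℝ) (hz : z ∈ Set.Icc (σ * x) (σ * y)) (i) : 0 < (σ * z) i := by
    have h1 := hz.1 i
    have h2 := hz.2 i
    have := hx i
    have := hy i
    simp only [σ, Pi.mul_apply] at h1 h2 ⊢
    split_ifs at h1 h2 ⊢ <;> linarith
  let m : (ι → ℝ) →L[ℝ] (ι → ℝ) := ContinuousLinearMap.mul ℝ (ι → ℝ) σ
  have h := eq_of_le_of_noSignReversal (F := fun z => m (F (m z)))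
    (F' := fun z => m.comp ((F' (σ * z)).comp m)) (a := σ * x) (b := σ * y)
    (fun z hz => m.hasFDerivAt.comp z ((hF (σ * z) (hpos z hz)).comp z m.hasFDerivAt))
    (fun z hz u hu => by
      have h0 : σ * u = 0 := hN (σ * z) (hpos z hz) _ fun i => by
        have := hu i
        simp only [m, ContinuousLinearMap.comp_apply, ContinuousLinearMap.mul_apply',
          Pi.mul_apply] at this ⊢
        linarith
      rw [← hσσ u, h0, mul_zero]) (x := σ * y) ⟨hle, le_rfl⟩
    (fun i _ => by simp only [m, ContinuousLinearMap.mul_apply', hσσ, hxy, le_refl])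
  rw [← hσσ x, ← h, hσσ]

/-- The entropy of order `m` of the distribution with multiplicities `c` and log-weights `x`. -/
noncomputable def expEntropy {ι : Type*} [Fintype ι] (c x : ι → ℝ) (m : ℝ) : ℝ :=
  Real.log (expSum c x m) - m * expSum (c * x) x m / expSum c x m

theorem expEntropy_sub_const {ι : Type*} [Fintype ι] [Nonempty ι] {c : ι → ℝ} (hc : ∀ j, 0 < c j)
    (x : ι → ℝ) (b m : ℝ) : expEntropy c (fun j => x j - b) m = expEntropy c x m := by
  have h : expSum (c * fun j => x j - b) x m = expSum (c * x) x m - b * expSum c x m := by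
    simp only [expSum, Finset.mul_sum, ← Finset.sum_sub_distrib, Pi.mul_apply]
    exact Finset.sum_congr rfl fun j _ => by ring
  have hZ := (expSum_pos hc x m).ne'
  simp only [expEntropy, expSum_sub_const, h]
  rw [Real.log_mul (Real.exp_pos _).ne' hZ, Real.log_exp]
  have := (Real.exp_pos (-(m * b))).ne'
  field_simp
  ring

theorem GSEstratum_eq_expEntropy {s : ℕ} [NeZero s] {n : Fin s → ℕ} (hn : ∀ j, 0 < n j) (m : ℝ)
    {a : Fin s → ℝ} (ha : ∀ j, 0 < a j) :
    GSEstratum s n m a = expEntropy (fun j => (n j : ℝ)) (fun j => Real.log (a j)) m := by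
  have hpow (j) : a j ^ m = Real.exp (m * Real.log (a j)) := by
    rw [Real.rpow_def_of_pos (ha j), mul_comm]
  have hZ := expSum_pos (c := fun j => (n j : ℝ)) (fun j => Nat.cast_pos.2 (hn j))
    (fun j => Real.log (a j)) m
  simp only [GSEstratum, hpow]
  change -∑ j, (n j : ℝ) * (_ / expSum (fun j => (n j : ℝ)) (fun j => Real.log (a j)) m) *
    Real.log (_ / expSum (fun j => (n j : ℝ)) (fun j => Real.log (a j)) m) = _
  set Z := expSum (fun j => (n j : ℝ)) (fun j => Real.log (a j)) m with hZdef
  have hterm (j : Fin s) : (n j : ℝ) * (Real.exp (m * Real.log (a j)) / Z) *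
      Real.log (Real.exp (m * Real.log (a j)) / Z) =
      m / Z * ((n j : ℝ) * Real.log (a j) * Real.exp (m * Real.log (a j))) -
        Real.log Z / Z * ((n j : ℝ) * Real.exp (m * Real.log (a j))) := by
    rw [Real.log_div (Real.exp_pos _).ne' hZ.ne', Real.log_exp]
    ring
  have h1 : ∑ j, (n j : ℝ) * Real.exp (m * Real.log (a j)) = Z := rfl
  rw [Finset.sum_congr rfl fun j _ => hterm j, Finset.sum_sub_distrib, ← Finset.mul_sum,
    ← Finset.mul_sum, h1, expEntropy, ← hZdef]
  simp only [expSum, Pi.mul_apply]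
  field_simp
  ring

theorem expEntropy_comp_equiv {ι : Type*} [Fintype ι] (c x : ι → ℝ) (e : ι ≃ ι) (m : ℝ) :
    expEntropy (fun j => c (e j)) (fun j => x (e j)) m = expEntropy c x m := by
  have h (c : ι → ℝ) : expSum (fun j => c (e j)) (fun j => x (e j)) m = expSum c x m :=
    e.sum_comp fun j => c j * Real.exp (m * x j)
  have h' := h (c * x)
  simp only [expEntropy, h]
  rw [← h']
  rfl

theorem hasDerivAt_expSum_line {ι : Type*} [Fintype ι] (c x v : ι → ℝ) (m : ℝ) :
    HasDerivAt (fun t : ℝ => expSum c (x + t • v) m) (m * expSum (c * v) x m) 0 := by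
  unfold expSum
  rw [Finset.mul_sum]
  refine HasDerivAt.fun_sum fun j _ => ?_
  have h := (((((hasDerivAt_id (0 : ℝ)).mul_const (v j)).const_add (x j)).const_mul m).exp).const_mul
    (c j)
  refine h.congr_deriv ?_
  simp only [id, Pi.mul_apply, zero_mul, add_zero]
  ring

theorem hasDerivAt_expEntropy_line {ι : Type*} [Fintype ι] [Nonempty ι] {c : ι → ℝ}
    (hc : ∀ j, 0 < c j) (x v : ι → ℝ) (m : ℝ) :
    HasDerivAt (fun t : ℝ => expEntropy c (x + t • v) m)
      (-(m ^ 2 / expSum c x m ^ 2 * expWronskian c x v m)) 0 := by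
  have hZ := (expSum_pos hc x m).ne'
  have hZd := hasDerivAt_expSum_line c x v m
  have hPd : HasDerivAt (fun t : ℝ => expSum (c * (x + t • v)) (x + t • v) m)
      (expSum (c * v) x m + m * expSum (c * v * x) x m) 0 := by
    have h := (hasDerivAt_expSum_line (c * x) x v m).add
      ((hasDerivAt_id (0 : ℝ)).mul (hasDerivAt_expSum_line (c * v) x v m))
    have he : (fun t : ℝ => expSum (c * (x + t • v)) (x + t • v) m) =
        fun t : ℝ => expSum (c * x) (x + t • v) m + t * expSum (c * v) (x + t • v) m := by
      funext t
      simp only [expSum, Finset.mul_sum, ← Finset.sum_add_distrib]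
      refine Finset.sum_congr rfl fun j _ => ?_
      simp only [Pi.mul_apply, Pi.add_apply, Pi.smul_apply, smul_eq_mul]
      ring
    rw [he]
    refine h.congr_deriv ?_
    simp only [id, zero_smul, add_zero, mul_right_comm c x v]
    ring
  have hZ0 : expSum c (x + (0 : ℝ) • v) m ≠ 0 := by simpa using hZ
  have h := (hZd.log hZ0).sub ((hPd.const_mul m).div hZd hZ0)
  refine h.congr_deriv ?_
  simp only [zero_smul, add_zero, expWronskian]
  field_simp
  ring

/-- The partial sums of `d`, starting from zero. -/
noncomputable def cumulative {N : ℕ} : (Fin N → ℝ) →L[ℝ] (Fin (N + 1) → ℝ) :=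
  ContinuousLinearMap.pi fun j => ∑ k : Fin N,
    if k.castSucc < j then ContinuousLinearMap.proj k else 0

theorem cumulative_succ_sub {N : ℕ} (d : Fin N → ℝ) (k : Fin N) :
    cumulative d k.succ - cumulative d k.castSucc = d k := by
  simp only [cumulative, ContinuousLinearMap.coe_pi', _root_.sum_apply,
    ← Finset.sum_sub_distrib]
  rw [Finset.sum_eq_single k]
  · simp
  · intro i _ hi
    have : i.castSucc < k.succ ↔ i.castSucc < k.castSucc := by
      simp only [Fin.lt_def, Fin.val_castSucc, Fin.val_succ]
      have : (i : ℕ) ≠ k := fun h => hi (Fin.ext h)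
      omega
    simp [this]
  · simp

theorem eq_cumulative {N : ℕ} (x : Fin (N + 1) → ℝ) (j : Fin (N + 1)) :
    x j - x 0 = cumulative (fun k : Fin N => x k.succ - x k.castSucc) j := by
  induction j using Fin.induction with
  | zero => simp [cumulative]
  | succ k hk =>
    have := cumulative_succ_sub (fun k : Fin N => x k.succ - x k.castSucc) k
    linarith

theorem strictMono_cumulative {N : ℕ} {d : Fin N → ℝ} (hd : ∀ k, 0 < d k) :
    StrictMono (cumulative d) :=
  Fin.strictMono_iff_lt_succ.2 fun k => sub_pos.1 (cumulative_succ_sub d k ▸ hd k)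

theorem differentiable_expEntropy_cumulative {N : ℕ} {c : Fin (N + 1) → ℝ} (hc : ∀ j, 0 < c j)
    (m : ℝ) : Differentiable ℝ fun d : Fin N → ℝ => expEntropy c (cumulative d) m := by
  intro d
  have hZ := (expSum_pos hc (cumulative d) m).ne'
  have hx (j) : Differentiable ℝ fun d : Fin N → ℝ => cumulative d j :=
    differentiable_pi.1 cumulative.differentiable j
  have h1 : Differentiable ℝ fun d : Fin N → ℝ => expSum c (cumulative d) m := by
    unfold expSum
    fun_prop
  have h2 : Differentiable ℝ fun d : Fin N → ℝ =>
      expSum (c * cumulative d) (cumulative d) m := by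
    unfold expSum
    simp only [Pi.mul_apply]
    fun_prop
  have h3 : DifferentiableAt ℝ (fun d : Fin N → ℝ =>
      m * expSum (c * cumulative d) (cumulative d) m * (expSum c (cumulative d) m)⁻¹) d :=
    ((h2 d).const_mul m).fun_mul ((h1 d).fun_inv hZ)
  have h4 : DifferentiableAt ℝ (fun d : Fin N → ℝ =>
      Real.log (expSum c (cumulative d) m)) d := (h1 d).log hZ
  simp only [expEntropy, div_eq_mul_inv]
  exact h4.fun_sub h3

/-- Entropies of `N` distinct positive orders determine the gaps between the log-weights. -/
theorem injOn_expEntropy_cumulative {N : ℕ} {c : Fin (N + 1) → ℝ} (hc : ∀ j, 0 < c j)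
    {p : Fin N → ℝ} (hp : StrictMono p) (hp0 : ∀ i, 0 < p i) :
    Set.InjOn (fun (d : Fin N → ℝ) i => -expEntropy c (cumulative d) (p i))
      {d | ∀ i, 0 < d i} := by
  have hdiff : Differentiable ℝ fun (d : Fin N → ℝ) i => -expEntropy c (cumulative d) (p i) :=
    differentiable_pi.2 fun i => (differentiable_expEntropy_cumulative hc (p i)).neg
  refine injOn_of_noSignReversal (fun z _ => (hdiff z).hasFDerivAt) fun z hz u hu => ?_
  have hformula (i) : fderiv ℝ (fun (d : Fin N → ℝ) i => -expEntropy c (cumulative d) (p i)) z u i =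
      p i ^ 2 / expSum c (cumulative z) (p i) ^ 2 *
        expWronskian c (cumulative z) (cumulative u) (p i) := by
    have hline : HasDerivAt (fun t : ℝ => z + t • u) u 0 := by
      simpa using ((hasDerivAt_id (0 : ℝ)).smul_const u).const_add z
    have hF0 := (hdiff (z + (0 : ℝ) • u)).hasFDerivAt
    have hd := hasDerivAt_pi.1 (hF0.comp_hasDerivAt 0 hline) i
    have he := (hasDerivAt_expEntropy_line hc (cumulative z) (cumulative u) (p i)).neg
    simp only [Function.comp_def, map_add, map_smul] at hd
    have := hd.unique he
    simpa using this
  funext k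
  have h := eq_zero_of_expWronskian_sign_reversal hc (strictMono_cumulative hz)
    (v := cumulative u) hp (fun k => by
      have h1 := hu k
      rw [hformula] at h1
      have h2 : 0 < p k ^ 2 / expSum c (cumulative z) (p k) ^ 2 :=
        div_pos (pow_pos (hp0 k) 2) (pow_pos (expSum_pos hc _ _) 2)
      rw [cumulative_succ_sub]
      by_contra! h3
      have := mul_pos h2 h3
      linarith) k
  rwa [cumulative_succ_sub] at h

/-- on the ordered stratum of distributions with known multiplicity structure
`(n_1, …, n_s)` (with `n_1 + ⋯ + n_s = K`), any `r ≥ s - 1` distinct positive orders of GSE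
determine the distribution. -/
theorem gse_multiplicity_sufficient
    (s K r : ℕ) (hs : 2 ≤ s)
    (n : Fin s → ℕ) (hn : ∀ j, 0 < n j) (hnK : ∑ j, n j = K)
    (M : Finset ℝ) (hMpos : ∀ m ∈ M, 0 < m) (hMcard : M.card = r) (hr : s - 1 ≤ r)
    (a a' : Fin s → ℝ)
    (ha : StrictAnti a) (ha' : StrictAnti a')
    (hapos : ∀ j, 0 < a j) (ha'pos : ∀ j, 0 < a' j)
    (hasum : ∑ j, (n j : ℝ) * a j = 1) (ha'sum : ∑ j, (n j : ℝ) * a' j = 1)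
    (hH : ∀ m ∈ M, GSEstratum s n m a = GSEstratum s n m a') :
    a = a' := by
  obtain ⟨N, rfl⟩ : ∃ N, s = N + 1 := ⟨s - 1, by omega⟩
  obtain ⟨T, hTM, hT⟩ := Finset.exists_subset_card_eq (show N ≤ M.card by omega)
  let c : Fin (N + 1) → ℝ := fun j => (n j.rev : ℝ)
  have hc (j) : 0 < c j := Nat.cast_pos.2 (hn _)
  let x (b : Fin (N + 1) → ℝ) (j : Fin (N + 1)) : ℝ := Real.log (b j.rev)
  let d (b : Fin (N + 1) → ℝ) (k : Fin N) : ℝ := x b k.succ - x b k.castSucc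
  have hd {b : Fin (N + 1) → ℝ} (hb : StrictAnti b) (hb0 : ∀ j, 0 < b j) (k) : 0 < d b k :=
    sub_pos.2 (Real.log_lt_log (hb0 _) (hb (Fin.rev_lt_rev.2 k.castSucc_lt_succ)))
  have hent {b : Fin (N + 1) → ℝ} (hb0 : ∀ j, 0 < b j) (m : ℝ) :
      GSEstratum (N + 1) n m b = expEntropy c (cumulative (d b)) m := by
    rw [GSEstratum_eq_expEntropy hn m hb0, ← expEntropy_comp_equiv _ _ Fin.revPerm,
      ← funext (eq_cumulative (x b)), expEntropy_sub_const hc]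
    rfl
  have hdd : d a = d a' := by
    refine injOn_expEntropy_cumulative hc (T.orderEmbOfFin hT).strictMono
      (fun i => hMpos _ (hTM (T.orderEmbOfFin_mem hT i))) (hd ha hapos) (hd ha' ha'pos)
      (funext fun i => ?_)
    simp only
    rw [← hent hapos, ← hent ha'pos, hH _ (hTM (T.orderEmbOfFin_mem hT i))]
  have hscale (j) : a j = Real.exp (x a 0 - x a' 0) * a' j := by
    have h1 := eq_cumulative (x a) j.rev
    have h2 := eq_cumulative (x a') j.rev
    change _ = cumulative (d a) _ at h1
    change _ = cumulative (d a') _ at h2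
    rw [hdd, ← h2] at h1
    simp only [x, Fin.rev_rev] at h1 ⊢
    nth_rw 1 [← Real.exp_log (hapos j)]
    nth_rw 1 [← Real.exp_log (ha'pos j)]
    rw [← Real.exp_add]
    exact congrArg Real.exp (by linarith)
  have hone : Real.exp (x a 0 - x a' 0) = 1 := by
    rw [← hasum, ← mul_one (Real.exp _), ← ha'sum, Finset.mul_sum]
    refine Finset.sum_congr rfl fun j _ => ?_
    rw [hscale j]
    ring
  funext j
  rw [hscale j, hone, one_mul]
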